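/- Let c > 0 and X_B, X_E, R_B, I_B, R_E, I_E be real numbers with y1 = X_B·R_E − X_E·R_B and y2 = X_B·I_E − X_E·I_B satisfying (y1, y2) ≠ (0, 0). Assume the denominator X_E + 2c·R_E·cos φ − 2c·I_E·sin φ is nonzero for all φ ∈ ℝ, and assume |2c·(R_E·I_B − R_B·I_E)| ≤ √(y1² + y2²). Let φ_y satisfy sin φ_y = y2/√(y1² + y2²) and cos φ_y = y1/√(y1² + y2²). Then φ_m := arcsin(2c·(R_E·I_B − R_B·I_E)/√(y1² + y2²)) − φ_y is a critical point of f(φ) = (X_B + 2c·R_B·cos φ − 2c·I_B·sin φ)/(X_E + 2c·R_E·cos φ − 2c·I_E·sin φ), i.e., f′(φ_m) = 0. -/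

import Mathlib

/-- Derivative of an affine trigonometric expression `X + a cos t - b sin t`. -/
theorem hasDerivAt_add_cos_sub_sin (X a b x : ℝ) :
    HasDerivAt (fun t : ℝ => X + a * Real.cos t - b * Real.sin t)
      (a * -Real.sin x - b * Real.cos x) x :=
  (((Real.hasDerivAt_cos x).const_mul a).const_add X).sub ((Real.hasDerivAt_sin x).const_mul b)

/-- Proposition 1: with `c = αP`, `y₁ = X_B R_E − X_E R_B` and `y₂ = X_B I_E − X_E I_B`
not both zero, denominator everywhere nonzero, and `|2c(R_E I_B − R_B I_E)| ≤ √(y₁²+y₂²)`,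
the phase `φₘ = arcsin(2c(R_E I_B − R_B I_E)/√(y₁²+y₂²)) − φ_y` is a critical point of the
SLNR `f(φ) = (X_B + 2c R_B cos φ − 2c I_B sin φ)/(X_E + 2c R_E cos φ − 2c I_E sin φ)`. -/
theorem stmt_2 (c XB XE RB IB RE IE φy : ℝ) (hc : 0 < c)
    (hy : (XB * RE - XE * RB, XB * IE - XE * IB) ≠ (0, 0))
    (hden : ∀ φ : ℝ, XE + 2 * c * RE * Real.cos φ - 2 * c * IE * Real.sin φ ≠ 0)
    (hle : |2 * c * (RE * IB - RB * IE)| ≤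
      Real.sqrt ((XB * RE - XE * RB) ^ 2 + (XB * IE - XE * IB) ^ 2))
    (hsin : Real.sin φy =
      (XB * IE - XE * IB) / Real.sqrt ((XB * RE - XE * RB) ^ 2 + (XB * IE - XE * IB) ^ 2))
    (hcos : Real.cos φy =
      (XB * RE - XE * RB) / Real.sqrt ((XB * RE - XE * RB) ^ 2 + (XB * IE - XE * IB) ^ 2)) :
    deriv
      (fun t : ℝ =>
        (XB + 2 * c * RB * Real.cos t - 2 * c * IB * Real.sin t) /
          (XE + 2 * c * RE * Real.cos t - 2 * c * IE * Real.sin t))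
      (Real.arcsin
          (2 * c * (RE * IB - RB * IE) /
            Real.sqrt ((XB * RE - XE * RB) ^ 2 + (XB * IE - XE * IB) ^ 2)) - φy) = 0 := by
  set r := Real.sqrt ((XB * RE - XE * RB) ^ 2 + (XB * IE - XE * IB) ^ 2) with hr
  have hrpos : 0 < r := by
    refine Real.sqrt_pos.2 ?_
    by_cases h : XB * RE - XE * RB = 0
    · have h' : XB * IE - XE * IB ≠ 0 := fun h' => hy (by rw [h, h'])
      positivity
    · positivity
  set x := Real.arcsin (2 * c * (RE * IB - RB * IE) / r) - φy with hx
  have hphase : Real.sin (x + φy) = 2 * c * (RE * IB - RB * IE) / r := by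
    obtain ⟨hlo, hhi⟩ := abs_le.1 hle
    rw [hx, sub_add_cancel]
    refine Real.sin_arcsin ?_ ?_
    · rwa [le_div_iff₀ hrpos, neg_one_mul]
    · rwa [div_le_one hrpos]
  have hcrit : (XB * RE - XE * RB) * Real.sin x + (XB * IE - XE * IB) * Real.cos x =
      2 * c * (RE * IB - RB * IE) := by
    rw [Real.sin_add, hsin, hcos] at hphase
    field_simp at hphase
    linarith
  have hderiv := (hasDerivAt_add_cos_sub_sin XB (2 * c * RB) (2 * c * IB) x).div
    (hasDerivAt_add_cos_sub_sin XE (2 * c * RE) (2 * c * IE) x) (hden x)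
  refine hderiv.deriv.trans (div_eq_zero_iff.2 (Or.inl ?_))
  linear_combination 2 * c * hcrit +
    4 * c ^ 2 * (RB * IE - RE * IB) * Real.sin_sq_add_cos_sq x
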